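/- arXiv:1903.08079 — 2 statements merged into one kernel-verified Lean document; each statement's English description precedes it below -/
import Mathlib

section
/- If e : M → E is a coneat injective envelope of a left R-module M, then E is a coneat essential extension of e(M); that is, e(M) is a coneat submodule of E and every homomorphism φ : E → X whose restriction to e(M) is injective and for which φ(e(M)) is coneat in φ(E) is itself injective. -/
/-!
Basic notions from the theory of coneat exact sequences.

A short exact sequence `0 → A → B → C → 0` of left `R`-modules is *coneat exact* if for every
simple right `R`-module `S` the induced map `S ⊗[R] A → S ⊗[R] B` is injective.  Since every
simple right `R`-module is isomorphic to `R ⧸ I` for a maximal right ideal `I` (realized below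
as a left ideal `I : Ideal Rᵐᵒᵖ`), and since `(R ⧸ I) ⊗[R] B ≅ B ⧸ I•B` (as abelian groups,
where `I•B` is the additive subgroup generated by the products `i • b`, `i ∈ I`, `b ∈ B`),
this is equivalent to the elementwise condition `A ∩ I•B ⊆ I•A` for every maximal right
ideal `I`, which is the formulation used here (Mathlib has no tensor product of a right module
with a left module over a noncommutative ring).
-/

universe u v

section Defs

variable (R : Type u) [Ring R]

/-- The additive subgroup of a left `R`-module `B` generated by the products `i • n` with
`i` in a right ideal `I` (realized as a left ideal of `Rᵐᵒᵖ`) and `n ∈ N`. -/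
def rIdealSMul {B : Type v} [AddCommGroup B] [Module R B] (I : Ideal Rᵐᵒᵖ) (N : Set B) :
    AddSubgroup B :=
  AddSubgroup.closure {x : B | ∃ i ∈ I, ∃ n ∈ N, x = MulOpposite.unop i • n}

/-- `A` is a *coneat submodule* of `B` : the sequence `0 → A → B → B ⧸ A → 0` remains exact
after tensoring with every simple right `R`-module, i.e. `A ∩ I•B ⊆ I•A` for every maximal
right ideal `I` of `R`. -/
def IsConeatSubmodule {B : Type v} [AddCommGroup B] [Module R B] (A : Submodule R B) : Prop :=
  ∀ I : Ideal Rᵐᵒᵖ, I.IsMaximal → ∀ a : B, a ∈ A →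
    a ∈ rIdealSMul R I (Set.univ : Set B) → a ∈ rIdealSMul R I (A : Set B)

/-- The short exact sequence `0 → A –f→ B –g→ C → 0` is *coneat exact*. -/
def IsConeatExactSeq {A B C : Type v} [AddCommGroup A] [Module R A] [AddCommGroup B] [Module R B]
    [AddCommGroup C] [Module R C] (f : A →ₗ[R] B) (g : B →ₗ[R] C) : Prop :=
  Function.Injective f ∧ Function.Surjective g ∧ Function.Exact f g ∧
    IsConeatSubmodule R (LinearMap.range f)

/-- A left `R`-module `M` is *coneat injective* if for every coneat submodule `A` of a left
`R`-module `B`, every homomorphism `A → M` extends to `B`. -/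
def IsConeatInjective (M : Type v) [AddCommGroup M] [Module R M] : Prop :=
  ∀ (B : ModuleCat.{v} R) (A : Submodule R B), IsConeatSubmodule R A →
    ∀ f : A →ₗ[R] M, ∃ g : B →ₗ[R] M, g.comp A.subtype = f

/-- `e : M → E` is a *coneat injective envelope* of `M` : `e` is injective, `E` is coneat
injective, every homomorphism from `M` to a coneat injective module factors through `e`, and
every endomorphism `f` of `E` with `f ∘ e = e` is an automorphism. -/
def IsConeatInjectiveEnvelope {M E : Type v} [AddCommGroup M] [Module R M] [AddCommGroup E]
    [Module R E] (e : M →ₗ[R] E) : Prop :=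
  Function.Injective e ∧ IsConeatInjective R E ∧
    (∀ (C : ModuleCat.{v} R), IsConeatInjective R C → ∀ g : M →ₗ[R] C,
      ∃ h : E →ₗ[R] C, h.comp e = g) ∧
    (∀ f : E →ₗ[R] E, f.comp e = e → Function.Bijective f)

/-- `M` is *`N`-coneat injective* if every homomorphism from a coneat submodule of `N`
to `M` extends to `N`. -/
def IsRelConeatInjective (M N : Type v) [AddCommGroup M] [Module R M] [AddCommGroup N]
    [Module R N] : Prop :=
  ∀ K : Submodule R N, IsConeatSubmodule R K →
    ∀ f : K →ₗ[R] M, ∃ g : N →ₗ[R] M, g.comp K.subtype = f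

/-- `M` is *quasi coneat injective* if it is `M`-coneat injective. -/
def IsQuasiConeatInjective (M : Type v) [AddCommGroup M] [Module R M] : Prop :=
  IsRelConeatInjective R M M

/-- `M` is *coneat-`N`-injective* if for (some, equivalently every) coneat injective envelope
`e : M → E`, every homomorphism `f : N → E` satisfies `f (N) ⊆ e (M)`. -/
def IsConeatRelInjective (M N : Type v) [AddCommGroup M] [Module R M] [AddCommGroup N]
    [Module R N] : Prop :=
  ∀ (E : ModuleCat.{v} R) (e : M →ₗ[R] E), IsConeatInjectiveEnvelope R e →
    ∀ f : N →ₗ[R] E, ∀ n : N, f n ∈ LinearMap.range e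

/-- `M` is *coneat quasi injective* if it is coneat-`M`-injective, i.e. fully invariant in its
coneat injective envelope. -/
def IsConeatQuasiInjective (M : Type v) [AddCommGroup M] [Module R M] : Prop :=
  IsConeatRelInjective R M M

/-- `A` is a *pure submodule* of `B` : the sequence `0 → A → B → B ⧸ A → 0` remains exact after
tensoring with every right `R`-module; elementwise (Cohn's criterion): every finite system of
linear equations `aᵢ = ∑ⱼ rᵢⱼ • xⱼ` with constants in `A` which is solvable in `B` is solvable
in `A`. -/
def IsPureSubmodule {B : Type v} [AddCommGroup B] [Module R B] (A : Submodule R B) : Prop :=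
  ∀ (m n : ℕ) (r : Fin m → Fin n → R) (a : Fin m → A),
    (∃ b : Fin n → B, ∀ i, (a i : B) = ∑ j, r i j • b j) →
    ∃ a' : Fin n → A, ∀ i, (a i : B) = ∑ j, r i j • (a' j : B)

/-- The short exact sequence `0 → A –f→ B –g→ C → 0` is *pure exact*. -/
def IsPureExactSeq {A B C : Type v} [AddCommGroup A] [Module R A] [AddCommGroup B] [Module R B]
    [AddCommGroup C] [Module R C] (f : A →ₗ[R] B) (g : B →ₗ[R] C) : Prop :=
  Function.Injective f ∧ Function.Surjective g ∧ Function.Exact f g ∧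
    IsPureSubmodule R (LinearMap.range f)

/-- A left `R`-module `M` is *pure injective* if for every pure submodule `A` of a left
`R`-module `B`, every homomorphism `A → M` extends to `B`. -/
def IsPureInjective (M : Type v) [AddCommGroup M] [Module R M] : Prop :=
  ∀ (B : ModuleCat.{v} R) (A : Submodule R B), IsPureSubmodule R A →
    ∀ f : A →ₗ[R] M, ∃ g : B →ₗ[R] M, g.comp A.subtype = f

/-- A right `R`-module `S` (i.e. a left `Rᵐᵒᵖ`-module) is *flat*, expressed through the
equational criterion (which over any ring is equivalent to `S ⊗[R] —` preserving injections):
every relation `∑ᵢ sᵢ aᵢ = 0` in `S` comes from relations in `R`. -/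
def IsFlatRightModule (S : Type v) [AddCommGroup S] [Module Rᵐᵒᵖ S] : Prop :=
  ∀ (m : ℕ) (a : Fin m → R) (s : Fin m → S),
    (∑ i, MulOpposite.op (a i) • s i) = 0 →
    ∃ (n : ℕ) (b : Fin n → Fin m → R) (t : Fin n → S),
      (∀ i, s i = ∑ j, MulOpposite.op (b j i) • t j) ∧ (∀ j, ∑ i, b j i * a i = 0)

/-- A left `R`-module `C` is *coneat flat* if `C ≅ B ⧸ A` for some coneat submodule `A ≤ B`. -/
def IsConeatFlat (C : Type v) [AddCommGroup C] [Module R C] : Prop :=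
  ∃ (B : ModuleCat.{v} R) (A : Submodule R B),
    IsConeatSubmodule R A ∧ Nonempty ((B ⧸ A) ≃ₗ[R] C)

end Defs

/-- A character of a subgroup `A` that vanishes on `A ∩ N` extends to a character of the whole
group vanishing on `N`. -/
theorem AddSubgroup.exists_character_extension {B : Type*} [AddCommGroup B] (A N : AddSubgroup B)
    (ψ : A →+ AddCircle (1 : ℚ)) (hψ : ∀ a : A, (a : B) ∈ N → ψ a = 0) :
    ∃ χ : B →+ AddCircle (1 : ℚ), (∀ a : A, χ a = ψ a) ∧ ∀ b ∈ N, χ b = 0 := by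
  let ι : A ⧸ N.comap A.subtype →+ B ⧸ N := QuotientAddGroup.map _ N A.subtype le_rfl
  have hι : Function.Injective ι := by
    rw [injective_iff_map_eq_zero]
    intro x hx
    obtain ⟨a, rfl⟩ := QuotientAddGroup.mk_surjective x
    exact (QuotientAddGroup.eq_zero_iff a).2 ((QuotientAddGroup.eq_zero_iff (a : B)).1 hx)
  obtain ⟨χ, hχ⟩ := (Module.Baer.of_divisible
    (AddCircle (1 : ℚ))).extension_property_addMonoidHom ι hι
    (QuotientAddGroup.lift (N.comap A.subtype) ψ fun a ha => hψ a ha)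
  refine ⟨χ.comp (QuotientAddGroup.mk' N), fun a => ?_, fun b hb => ?_⟩
  · exact DFunLike.congr_fun hχ (QuotientAddGroup.mk a)
  · change χ (QuotientAddGroup.mk b) = 0
    rw [(QuotientAddGroup.eq_zero_iff b).2 hb, map_zero]

section CharacterDual

variable {R : Type u} [Ring R]

/-- The character dual of the right module `R ⧸ I`, realized as the group of characters of `R`
vanishing on the right ideal `I`. -/
def RIdealCharacterDual (I : Ideal Rᵐᵒᵖ) : Type u :=
  {f : R →+ AddCircle (1 : ℚ) // ∀ x ∈ I, f x.unop = 0}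

namespace RIdealCharacterDual

variable {I : Ideal Rᵐᵒᵖ}

/-- The subgroup of characters of `R` underlying `RIdealCharacterDual I`. -/
def toAddSubgroup (I : Ideal Rᵐᵒᵖ) : AddSubgroup (R →+ AddCircle (1 : ℚ)) where
  carrier := {f | ∀ x ∈ I, f x.unop = 0}
  zero_mem' _ _ := rfl
  add_mem' hf hg x hx := by simp [hf x hx, hg x hx]
  neg_mem' hf x hx := by simp [hf x hx]

noncomputable instance : AddCommGroup (RIdealCharacterDual I) :=
  inferInstanceAs (AddCommGroup (toAddSubgroup I))

instance : FunLike (RIdealCharacterDual I) R (AddCircle (1 : ℚ)) where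
  coe f := f.1
  coe_injective _ _ h := Subtype.ext (DFunLike.coe_injective h)

instance : AddMonoidHomClass (RIdealCharacterDual I) R (AddCircle (1 : ℚ)) where
  map_add f := f.1.map_add
  map_zero f := f.1.map_zero

@[ext] theorem ext {f g : RIdealCharacterDual I} (h : ∀ x, f x = g x) : f = g :=
  DFunLike.ext _ _ h

theorem apply_eq_zero (f : RIdealCharacterDual I) {x : Rᵐᵒᵖ} (hx : x ∈ I) : f x.unop = 0 :=
  f.2 x hx

@[simp] theorem add_apply (f g : RIdealCharacterDual I) (x : R) : (f + g) x = f x + g x := rfl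

@[simp] theorem zero_apply (x : R) : (0 : RIdealCharacterDual I) x = 0 := rfl

instance : SMul R (RIdealCharacterDual I) where
  smul r f := ⟨f.1.comp (AddMonoidHom.mulRight r),
    fun _ hx => f.2 _ (I.mul_mem_left (MulOpposite.op r) hx)⟩

@[simp] theorem smul_apply (r : R) (f : RIdealCharacterDual I) (x : R) :
    (r • f) x = f (x * r) := rfl

noncomputable instance : Module R (RIdealCharacterDual I) where
  one_smul f := by ext; simp
  mul_smul r s f := by ext; simp [mul_assoc]
  smul_zero r := by ext; simp
  smul_add r f g := by ext; simp
  add_smul r s f := by ext; simp [mul_add]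
  zero_smul f := by ext; simp

/-- Evaluation at `1`. -/
noncomputable def evalOne (I : Ideal Rᵐᵒᵖ) : RIdealCharacterDual I →+ AddCircle (1 : ℚ) where
  toFun f := f 1
  map_zero' := rfl
  map_add' _ _ := rfl

/-- A character of `B` vanishing on `I•B` induces a homomorphism from `B` to
`RIdealCharacterDual I`. -/
noncomputable def lift {B : Type v} [AddCommGroup B] [Module R B] (χ : B →+ AddCircle (1 : ℚ))
    (hχ : ∀ b ∈ rIdealSMul R I (Set.univ : Set B), χ b = 0) :
    B →ₗ[R] RIdealCharacterDual I where
  toFun b := ⟨χ.comp ((smulAddHom R B).flip b),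
    fun x hx => hχ _ (AddSubgroup.subset_closure ⟨x, hx, b, trivial, rfl⟩)⟩
  map_add' a b := by
    ext x
    change χ (x • (a + b)) = χ (x • a) + χ (x • b)
    rw [smul_add, map_add]
  map_smul' r b := by
    ext x
    change χ (x • r • b) = χ ((x * r) • b)
    rw [mul_smul]

@[simp] theorem lift_apply {B : Type v} [AddCommGroup B] [Module R B]
    (χ : B →+ AddCircle (1 : ℚ)) (hχ : ∀ b ∈ rIdealSMul R I (Set.univ : Set B), χ b = 0)
    (b : B) (x : R) : lift χ hχ b x = χ (x • b) := rfl

theorem apply_one_eq_zero {f : RIdealCharacterDual I}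
    (hf : f ∈ rIdealSMul R I (Set.univ : Set (RIdealCharacterDual I))) : f 1 = 0 := by
  have h : rIdealSMul R I (Set.univ : Set (RIdealCharacterDual I)) ≤ (evalOne I).ker := by
    refine (AddSubgroup.closure_le _).2 ?_
    rintro _ ⟨i, hi, g, -, rfl⟩
    change g (1 * i.unop) = 0
    rw [one_mul, g.apply_eq_zero hi]
  exact h hf

theorem isConeatInjective (hI : I.IsMaximal) : IsConeatInjective R (RIdealCharacterDual I) := by
  intro B A hA f
  have hf : ∀ b ∈ rIdealSMul R I (A : Set B), ∃ h : b ∈ A, f ⟨b, h⟩ 1 = 0 := by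
    intro b hb
    have h : rIdealSMul R I (A : Set B) ≤
        (((evalOne I).comp f.toAddMonoidHom).ker).map A.subtype.toAddMonoidHom := by
      refine (AddSubgroup.closure_le _).2 ?_
      rintro _ ⟨i, hi, a, ha, rfl⟩
      refine ⟨i.unop • ⟨a, ha⟩, ?_, rfl⟩
      change f (i.unop • ⟨a, ha⟩) 1 = 0
      rw [map_smul, smul_apply, one_mul, apply_eq_zero _ hi]
    obtain ⟨a, ha, rfl⟩ := h hb
    exact ⟨a.2, ha⟩
  obtain ⟨χ, hχA, hχI⟩ := A.toAddSubgroup.exists_character_extension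
    (rIdealSMul R I Set.univ) ((evalOne I).comp f.toAddMonoidHom)
    fun a ha => (hf a (hA I hI a a.2 ha)).2
  refine ⟨lift χ hχI, ?_⟩
  ext a x
  change χ ((x • a : A) : B) = f a x
  rw [hχA (x • a)]
  change f (x • a) 1 = f a x
  rw [map_smul, smul_apply, one_mul]

end RIdealCharacterDual

theorem map_mem_rIdealSMul {M : Type*} {N : Type*} [AddCommGroup M] [Module R M]
    [AddCommGroup N] [Module R N] (f : M →ₗ[R] N) {I : Ideal Rᵐᵒᵖ} {S : Set M} {m : M}
    (hm : m ∈ rIdealSMul R I S) : f m ∈ rIdealSMul R I (f '' S) := by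
  have h : rIdealSMul R I S ≤ (rIdealSMul R I (f '' S)).comap f.toAddMonoidHom := by
    refine (AddSubgroup.closure_le _).2 ?_
    rintro _ ⟨i, hi, n, hn, rfl⟩
    exact AddSubgroup.subset_closure ⟨i, hi, f n, ⟨n, hn, rfl⟩, map_smul f _ _⟩
  exact h hm

/-- If every homomorphism from `M` to a coneat injective module factors through `e`, then the
range of `e` is coneat. -/
theorem isConeatSubmodule_range_of_factors {M E : Type u} [AddCommGroup M] [Module R M]
    [AddCommGroup E] [Module R E] (e : M →ₗ[R] E)
    (he : ∀ (C : ModuleCat.{u} R), IsConeatInjective R C → ∀ g : M →ₗ[R] C,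
      ∃ h : E →ₗ[R] C, h.comp e = g) :
    IsConeatSubmodule R (LinearMap.range e) := by
  rintro I hI _ ⟨m, rfl⟩ hm
  suffices h : m ∈ rIdealSMul R I (Set.univ : Set M) by
    rw [LinearMap.coe_range, ← Set.image_univ]
    exact map_mem_rIdealSMul e h
  by_contra hmI
  obtain ⟨c, hc⟩ := CharacterModule.exists_character_apply_ne_zero_of_ne_zero
    (mt (QuotientAddGroup.eq_zero_iff (N := rIdealSMul R I (Set.univ : Set M)) m).1 hmI)
  let χ : M →+ AddCircle (1 : ℚ) :=
    AddMonoidHom.comp c (QuotientAddGroup.mk' (rIdealSMul R I (Set.univ : Set M)))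
  have hχ : ∀ b ∈ rIdealSMul R I (Set.univ : Set M), χ b = 0 := fun b hb => by
    change c (QuotientAddGroup.mk b) = 0
    rw [(QuotientAddGroup.eq_zero_iff b).2 hb, map_zero]
  obtain ⟨h, hh⟩ := he (ModuleCat.of R (RIdealCharacterDual I))
    (RIdealCharacterDual.isConeatInjective hI) (RIdealCharacterDual.lift χ hχ)
  have key : RIdealCharacterDual.lift χ hχ m 1 = 0 := by
    rw [← hh]
    refine RIdealCharacterDual.apply_one_eq_zero ?_
    refine AddSubgroup.closure_mono ?_ (map_mem_rIdealSMul h hm)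
    rintro x ⟨i, hi, n, -, hx⟩
    exact ⟨i, hi, n, trivial, hx⟩
  rw [RIdealCharacterDual.lift_apply, one_smul] at key
  exact hc key

end CharacterDual

/-- If `e : M → E` is a coneat injective envelope, then `E` is a coneat
essential extension of `e(M)`: `e(M)` is coneat in `E`, and every homomorphism `φ : E → X`
whose restriction to `e(M)` is injective and such that `φ(e(M))` is coneat in `φ(E)` is
itself injective. -/
theorem coneatInjectiveEnvelope_coneat_essential (R : Type u) [Ring R]
    (M E : Type u) [AddCommGroup M] [Module R M] [AddCommGroup E] [Module R E]
    (e : M →ₗ[R] E) (he : IsConeatInjectiveEnvelope R e) :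
    IsConeatSubmodule R (LinearMap.range e) ∧
      ∀ (X : ModuleCat.{u} R) (φ : E →ₗ[R] X),
        Function.Injective (φ.comp e) →
        IsConeatSubmodule R
          (Submodule.comap (LinearMap.range φ).subtype (LinearMap.range (φ.comp e))) →
        Function.Injective φ := by
  obtain ⟨-, hE, hfac, haut⟩ := he
  refine ⟨isConeatSubmodule_range_of_factors e hfac, fun X φ hφ hcon => ?_⟩
  let j : M →ₗ[R] LinearMap.range φ := φ.rangeRestrict.comp e
  have hj : Function.Injective j := fun a b hab => hφ (congrArg Subtype.val hab)
  have hrange : Submodule.comap (LinearMap.range φ).subtype (LinearMap.range (φ.comp e)) =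
      LinearMap.range j := by
    ext y
    exact ⟨fun ⟨m, hm⟩ => ⟨m, Subtype.ext hm⟩, fun ⟨m, hm⟩ => ⟨m, congrArg Subtype.val hm⟩⟩
  rw [hrange] at hcon
  obtain ⟨g, hg⟩ := hE (ModuleCat.of R (LinearMap.range φ)) (LinearMap.range j) hcon
    (e.comp (LinearEquiv.ofInjective j hj).symm.toLinearMap)
  have hcomp : (g.comp φ.rangeRestrict).comp e = e := by
    ext m
    refine (LinearMap.congr_fun hg (LinearEquiv.ofInjective j hj m)).trans ?_
    simp
  intro x y hxy
  exact (haut _ hcomp).1 (congrArg g (Subtype.ext hxy))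
end

section
/- For left R-modules M₁ and M₂, the direct sum M₁ ⊕ M₂ is coneat quasi injective if and only if Mᵢ is coneat-Mⱼ-injective for all i, j ∈ {1, 2}. -/
/-!
Basic notions from the theory of coneat exact sequences.

A short exact sequence `0 → A → B → C → 0` of left `R`-modules is *coneat exact* if for every
simple right `R`-module `S` the induced map `S ⊗[R] A → S ⊗[R] B` is injective.  Since every
simple right `R`-module is isomorphic to `R ⧸ I` for a maximal right ideal `I` (realized below
as a left ideal `I : Ideal Rᵐᵒᵖ`), and since `(R ⧸ I) ⊗[R] B ≅ B ⧸ I•B` (as abelian groups,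
where `I•B` is the additive subgroup generated by the products `i • b`, `i ∈ I`, `b ∈ B`),
this is equivalent to the elementwise condition `A ∩ I•B ⊆ I•A` for every maximal right
ideal `I`, which is the formulation used here (Mathlib has no tensor product of a right module
with a left module over a noncommutative ring).
-/

universe u v

section ConeatMono

variable {R : Type u} [Ring R]

theorem map_mem_rIdealSMul_s13 {A B : Type v} [AddCommGroup A] [Module R A] [AddCommGroup B]
    [Module R B] (f : A →ₗ[R] B) (I : Ideal Rᵐᵒᵖ) (S : Set A) (T : Set B)
    (h : Set.MapsTo f S T) {a : A} (ha : a ∈ rIdealSMul R I S) : f a ∈ rIdealSMul R I T := by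
  induction ha using AddSubgroup.closure_induction with
  | mem x hx =>
    obtain ⟨i, hi, n, hn, rfl⟩ := hx
    exact AddSubgroup.subset_closure ⟨i, hi, f n, h hn, by simp⟩
  | zero => simp
  | add x y _ _ hx hy => rw [map_add]; exact add_mem hx hy
  | neg x _ hx => rw [map_neg]; exact neg_mem hx

theorem exists_preimage_mem_rIdealSMul {A B : Type v} [AddCommGroup A] [Module R A]
    [AddCommGroup B] [Module R B] (f : A →ₗ[R] B) (I : Ideal Rᵐᵒᵖ) (T : Set B)
    (h : T ⊆ Set.range f) {b : B} (hb : b ∈ rIdealSMul R I T) :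
    ∃ a ∈ rIdealSMul R I (Set.univ : Set A), f a = b := by
  induction hb using AddSubgroup.closure_induction with
  | mem x hx =>
    obtain ⟨i, hi, n, hn, rfl⟩ := hx
    obtain ⟨m, rfl⟩ := h hn
    exact ⟨MulOpposite.unop i • m,
      AddSubgroup.subset_closure ⟨i, hi, m, Set.mem_univ _, rfl⟩, by simp⟩
  | zero => exact ⟨0, zero_mem _, map_zero f⟩
  | add x y _ _ hx hy =>
    obtain ⟨a, ha, rfl⟩ := hx
    obtain ⟨a', ha', rfl⟩ := hy
    exact ⟨a + a', add_mem ha ha', map_add f a a'⟩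
  | neg x _ hx =>
    obtain ⟨a, ha, rfl⟩ := hx
    exact ⟨-a, neg_mem ha, map_neg f a⟩

theorem mem_rIdealSMul_bot_iff {A : Type v} [AddCommGroup A] [Module R A] (S : Set A) (a : A) :
    a ∈ rIdealSMul R (⊥ : Ideal Rᵐᵒᵖ) S ↔ a = 0 := by
  refine ⟨fun ha => ?_, fun ha => ha ▸ zero_mem _⟩
  induction ha using AddSubgroup.closure_induction with
  | mem x hx =>
    obtain ⟨i, hi, n, hn, rfl⟩ := hx
    simp [(Submodule.mem_bot _).1 hi]
  | zero => rfl
  | add x y _ _ hx hy => simp [hx, hy]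
  | neg x _ hx => simp [hx]

/-- A homomorphism is a coneat monomorphism if it reflects membership in `I • _` for `I = 0`
(so that it is injective) and for every maximal right ideal `I` (so that its range is coneat). -/
def IsConeatMono {A B : Type v} [AddCommGroup A] [Module R A] [AddCommGroup B] [Module R B]
    (f : A →ₗ[R] B) : Prop :=
  ∀ I : Ideal Rᵐᵒᵖ, (I = ⊥ ∨ I.IsMaximal) → ∀ a : A,
    f a ∈ rIdealSMul R I (Set.univ : Set B) → a ∈ rIdealSMul R I (Set.univ : Set A)

namespace IsConeatMono

variable {A B C : Type v} [AddCommGroup A] [Module R A] [AddCommGroup B] [Module R B]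
  [AddCommGroup C] [Module R C]

theorem injective {f : A →ₗ[R] B} (hf : IsConeatMono f) : Function.Injective f := by
  refine (injective_iff_map_eq_zero f).2 fun a ha => ?_
  exact (mem_rIdealSMul_bot_iff _ a).1 (hf ⊥ (Or.inl rfl) a (ha ▸ zero_mem _))

theorem isConeatSubmodule_range {f : A →ₗ[R] B} (hf : IsConeatMono f) :
    IsConeatSubmodule R (LinearMap.range f) := by
  rintro I hI _ ⟨a, rfl⟩ ha
  exact map_mem_rIdealSMul_s13 f I Set.univ (LinearMap.range f : Set B) (fun x _ => ⟨x, rfl⟩)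
    (hf I (Or.inr hI) a ha)

theorem of_comp {f : A →ₗ[R] B} {g : B →ₗ[R] C} (h : IsConeatMono (g.comp f)) :
    IsConeatMono f :=
  fun I hI a ha => h I hI a (map_mem_rIdealSMul_s13 g I _ _ (Set.mapsTo_univ _ _) ha)

end IsConeatMono

theorem IsConeatSubmodule.isConeatMono_subtype {B : Type v} [AddCommGroup B] [Module R B]
    {A : Submodule R B} (hA : IsConeatSubmodule R A) : IsConeatMono A.subtype := by
  rintro I (rfl | hI) a ha
  · rw [mem_rIdealSMul_bot_iff] at ha ⊢
    exact A.subtype_injective (by simpa using ha)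
  · obtain ⟨a', ha', h⟩ := exists_preimage_mem_rIdealSMul A.subtype I (A : Set B)
      Subtype.range_coe.ge (hA I hI _ a.2 ha)
    rwa [← A.subtype_injective h]

theorem IsConeatInjective.exists_extension {E : Type v} [AddCommGroup E] [Module R E]
    (hE : IsConeatInjective R E) {A B : Type v} [AddCommGroup A] [Module R A]
    [AddCommGroup B] [Module R B] {i : A →ₗ[R] B} (hi : IsConeatMono i) (g : A →ₗ[R] E) :
    ∃ h : B →ₗ[R] E, h.comp i = g := by
  let q := LinearEquiv.ofInjective i hi.injective
  obtain ⟨h, hh⟩ := hE (ModuleCat.of R B) (LinearMap.range i) hi.isConeatSubmodule_range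
    (g.comp q.symm.toLinearMap)
  refine ⟨h, LinearMap.ext fun a => ?_⟩
  have := LinearMap.congr_fun hh (q a)
  simpa [q] using this

theorem IsConeatInjective.of_retract {E F : Type v} [AddCommGroup E] [Module R E]
    [AddCommGroup F] [Module R F] (hF : IsConeatInjective R F) (s : E →ₗ[R] F) (r : F →ₗ[R] E)
    (h : ∀ x, r (s x) = x) : IsConeatInjective R E := by
  intro B A hA f
  obtain ⟨g, hg⟩ := hF B A hA (s.comp f)
  refine ⟨r.comp g, LinearMap.ext fun a => ?_⟩
  have := LinearMap.congr_fun hg a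
  simp only [LinearMap.comp_apply] at this ⊢
  rw [this, h]

theorem IsConeatInjective.pi {ι : Type v} {E : ι → Type v} [∀ i, AddCommGroup (E i)]
    [∀ i, Module R (E i)] (h : ∀ i, IsConeatInjective R (E i)) :
    IsConeatInjective R (∀ i, E i) := by
  intro B A hA f
  choose g hg using fun i => h i B A hA ((LinearMap.proj i).comp f)
  refine ⟨LinearMap.pi g, LinearMap.ext fun a => funext fun i => ?_⟩
  exact LinearMap.congr_fun (hg i) a

theorem IsConeatInjective.prod {E F : Type v} [AddCommGroup E] [Module R E]
    [AddCommGroup F] [Module R F] (hE : IsConeatInjective R E) (hF : IsConeatInjective R F) :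
    IsConeatInjective R (E × F) := by
  intro B A hA f
  obtain ⟨g, hg⟩ := hE B A hA ((LinearMap.fst R E F).comp f)
  obtain ⟨k, hk⟩ := hF B A hA ((LinearMap.snd R E F).comp f)
  refine ⟨g.prod k, LinearMap.ext fun a => Prod.ext ?_ ?_⟩
  · exact LinearMap.congr_fun hg a
  · exact LinearMap.congr_fun hk a

end ConeatMono

section EnoughInjectives

theorem exists_addMonoidHom_extension {A B : Type*} [AddCommGroup A] [AddCommGroup B]
    (i : A →+ B) (H : AddSubgroup B) (ψ : A →+ AddCircle (1 : ℚ))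
    (hψ : ∀ a, i a ∈ H → ψ a = 0) :
    ∃ ψ' : B →+ AddCircle (1 : ℚ), (∀ x ∈ H, ψ' x = 0) ∧ ∀ a, ψ' (i a) = ψ a := by
  let j : A ⧸ H.comap i →+ B ⧸ H := QuotientAddGroup.map _ _ i le_rfl
  have hj : Function.Injective j := by
    refine (injective_iff_map_eq_zero j).2 fun x => ?_
    obtain ⟨a, rfl⟩ := QuotientAddGroup.mk_surjective x
    intro h
    exact (QuotientAddGroup.eq_zero_iff a).2 ((QuotientAddGroup.eq_zero_iff (i a)).1 h)
  obtain ⟨χ, hχ⟩ := (Module.Baer.of_divisible (AddCircle (1 : ℚ))).extension_property_addMonoidHom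
    j hj (QuotientAddGroup.lift (H.comap i) ψ hψ)
  refine ⟨χ.comp (QuotientAddGroup.mk' H), fun x hx => ?_, fun a => ?_⟩
  · have : (QuotientAddGroup.mk' H) x = 0 := (QuotientAddGroup.eq_zero_iff x).2 hx
    rw [AddMonoidHom.comp_apply, this, map_zero]
  · exact DFunLike.congr_fun hχ (QuotientAddGroup.mk a)

theorem mem_of_forall_character {A : Type*} [AddCommGroup A] (H : AddSubgroup A) (a : A)
    (h : ∀ ψ : A →+ AddCircle (1 : ℚ), (∀ x ∈ H, ψ x = 0) → ψ a = 0) : a ∈ H := by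
  rw [← QuotientAddGroup.eq_zero_iff]
  refine CharacterModule.eq_zero_of_character_apply fun c => ?_
  refine h (AddMonoidHom.comp c (QuotientAddGroup.mk' H)) fun x hx => ?_
  exact (congrArg c ((QuotientAddGroup.eq_zero_iff x).2 hx)).trans (map_zero c)

variable (R : Type u) [Ring R]

/-- The additive characters of `R`, as a left `R`-module via `(r • χ) s = χ (s * r)`. -/
def RingCharacter : Type u := R →+ AddCircle (1 : ℚ)

namespace RingCharacter

instance : AddCommGroup (RingCharacter R) :=
  inferInstanceAs (AddCommGroup (R →+ AddCircle (1 : ℚ)))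

instance : FunLike (RingCharacter R) R (AddCircle (1 : ℚ)) :=
  inferInstanceAs (FunLike (R →+ AddCircle (1 : ℚ)) R (AddCircle (1 : ℚ)))

instance : AddMonoidHomClass (RingCharacter R) R (AddCircle (1 : ℚ)) :=
  inferInstanceAs (AddMonoidHomClass (R →+ AddCircle (1 : ℚ)) R (AddCircle (1 : ℚ)))

variable {R}

@[ext] theorem ext {χ ξ : RingCharacter R} (h : ∀ s, χ s = ξ s) : χ = ξ := DFunLike.ext _ _ h

theorem add_apply (χ ξ : RingCharacter R) (s : R) : (χ + ξ) s = χ s + ξ s := rfl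

theorem zero_apply (s : R) : (0 : RingCharacter R) s = 0 := rfl

instance : SMul R (RingCharacter R) :=
  ⟨fun r χ => AddMonoidHom.comp (χ : R →+ AddCircle (1 : ℚ)) (AddMonoidHom.mulRight r)⟩

theorem smul_apply (r : R) (χ : RingCharacter R) (s : R) : (r • χ) s = χ (s * r) := rfl

instance : Module R (RingCharacter R) where
  one_smul χ := by ext s; simp [smul_apply]
  mul_smul r t χ := by ext s; simp [smul_apply, mul_assoc]
  smul_zero r := rfl
  smul_add r χ ξ := rfl
  add_smul r t χ := by ext s; simp [smul_apply, add_apply, mul_add]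
  zero_smul χ := by ext s; simp [smul_apply, zero_apply]

/-- The characters of `R` that vanish on the right ideal `I`, i.e. the character module of
`R ⧸ I`. -/
def vanishing (I : Ideal Rᵐᵒᵖ) : Submodule R (RingCharacter R) where
  carrier := {χ | ∀ i ∈ I, χ (MulOpposite.unop i) = 0}
  zero_mem' := fun _ _ => rfl
  add_mem' := fun {χ ξ} hχ hξ i hi => by rw [add_apply, hχ i hi, hξ i hi, add_zero]
  smul_mem' := fun r χ hχ i hi => by
    rw [smul_apply]
    exact hχ (MulOpposite.op r * i) (I.mul_mem_left _ hi)

/-- A character of `B` that vanishes on `I • B` induces a homomorphism from `B` to the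
characters of `R ⧸ I`. -/
def lift {B : Type v} [AddCommGroup B] [Module R B] (I : Ideal Rᵐᵒᵖ)
    (ψ : B →+ AddCircle (1 : ℚ)) (hψ : ∀ x ∈ rIdealSMul R I (Set.univ : Set B), ψ x = 0) :
    B →ₗ[R] vanishing I where
  toFun b := ⟨(ψ.comp ((AddMonoidHom.flip (smulAddHom R B)) b) : R →+ AddCircle (1 : ℚ)),
    fun i hi => hψ _ (AddSubgroup.subset_closure ⟨i, hi, b, Set.mem_univ _, rfl⟩)⟩
  map_add' b c := by
    refine Subtype.ext (ext fun s => ?_)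
    exact (congrArg ψ (smul_add s b c)).trans (map_add ψ _ _)
  map_smul' r b := by
    refine Subtype.ext (ext fun s => ?_)
    exact congrArg ψ (smul_smul s r b)

theorem lift_apply {B : Type v} [AddCommGroup B] [Module R B] (I : Ideal Rᵐᵒᵖ)
    (ψ : B →+ AddCircle (1 : ℚ)) (hψ : ∀ x ∈ rIdealSMul R I (Set.univ : Set B), ψ x = 0)
    (b : B) (s : R) : (lift I ψ hψ b).1 s = ψ (s • b) := rfl

theorem apply_one_eq_zero (I : Ideal Rᵐᵒᵖ) (χ : vanishing I)
    (hχ : χ ∈ rIdealSMul R I (Set.univ : Set (vanishing I))) : χ.1 1 = 0 := by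
  induction hχ using AddSubgroup.closure_induction with
  | mem x hx =>
    obtain ⟨i, hi, n, hn, rfl⟩ := hx
    rw [Submodule.coe_smul, smul_apply, one_mul]
    exact n.2 i hi
  | zero => rfl
  | add x y _ _ hx hy => rw [Submodule.coe_add, add_apply, hx, hy, add_zero]
  | neg x _ hx =>
    change -(x.1 1) = 0
    rw [hx, neg_zero]

theorem isConeatInjective_vanishing (I : Ideal Rᵐᵒᵖ) (hI : I = ⊥ ∨ I.IsMaximal) :
    IsConeatInjective R (vanishing I) := by
  intro B A hA f
  let ψ : A →+ AddCircle (1 : ℚ) :=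
    { toFun := fun a => (f a).1 1
      map_zero' := by rw [map_zero]; rfl
      map_add' := fun a b => by rw [map_add]; rfl }
  obtain ⟨ψ', hψ', h⟩ := exists_addMonoidHom_extension A.subtype.toAddMonoidHom
    (rIdealSMul R I (Set.univ : Set B)) ψ fun a ha => by
      exact apply_one_eq_zero I _ (map_mem_rIdealSMul_s13 f I Set.univ _ (Set.mapsTo_univ _ _)
        (hA.isConeatMono_subtype I hI a ha))
  refine ⟨lift I ψ' hψ', LinearMap.ext fun a => Subtype.ext (ext fun s => ?_)⟩
  rw [LinearMap.comp_apply, lift_apply]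
  refine (h (s • a)).trans ?_
  change (f (s • a)).1 1 = _
  rw [map_smul, Submodule.coe_smul, smul_apply, one_mul]

end RingCharacter

/-- Every module has a coneat monomorphism into a coneat injective module. -/
theorem exists_isConeatMono_isConeatInjective {R : Type u} [Ring R] (M : Type u) [AddCommGroup M]
    [Module R M] :
    ∃ (W : ModuleCat.{u} R) (e : M →ₗ[R] W), IsConeatInjective R W ∧ IsConeatMono e := by
  let ι := Σ I : {I : Ideal Rᵐᵒᵖ // I = ⊥ ∨ I.IsMaximal},
    {ψ : M →+ AddCircle (1 : ℚ) // ∀ x ∈ rIdealSMul R I.1 (Set.univ : Set M), ψ x = 0}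
  refine ⟨ModuleCat.of R (∀ k : ι, RingCharacter.vanishing (R := R) k.1.1),
    LinearMap.pi fun k : ι => RingCharacter.lift k.1.1 k.2.1 k.2.2,
    IsConeatInjective.pi fun k => RingCharacter.isConeatInjective_vanishing k.1.1 k.1.2,
    fun I hI a ha => ?_⟩
  refine mem_of_forall_character _ a fun ψ hψ => ?_
  let k : ι := ⟨⟨I, hI⟩, ⟨ψ, hψ⟩⟩
  have := RingCharacter.apply_one_eq_zero I _ (map_mem_rIdealSMul_s13
    (LinearMap.proj (R := R) (φ := fun k : ι => RingCharacter.vanishing (R := R) k.1.1) k) I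
    Set.univ Set.univ (Set.mapsTo_univ _ _) ha)
  have h2 : ψ ((1 : R) • a) = 0 := this
  rwa [one_smul] at h2

end EnoughInjectives

section Envelope

variable {R : Type u} [Ring R]

/-- `e : M → N` is *coneat essential* if every homomorphism from `N` whose composite with `e` is
a coneat monomorphism is injective. -/
def IsConeatEssential {M N : Type u} [AddCommGroup M] [Module R M] [AddCommGroup N] [Module R N]
    (e : M →ₗ[R] N) : Prop :=
  ∀ (X : Type u) [AddCommGroup X] [Module R X] (φ : N →ₗ[R] X),
    IsConeatMono (φ.comp e) → Function.Injective φ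

theorem exists_comp_eq_of_ker_le {A B C : Type*} [AddCommGroup A] [Module R A]
    [AddCommGroup B] [Module R B] [AddCommGroup C] [Module R C] (p : A →ₗ[R] B)
    (hp : Function.Surjective p) (q : A →ₗ[R] C) (h : LinearMap.ker p ≤ LinearMap.ker q) :
    ∃ θ : B →ₗ[R] C, θ.comp p = q := by
  refine ⟨((LinearMap.ker p).liftQ q h).comp
    (p.quotKerEquivOfSurjective hp).symm.toLinearMap, LinearMap.ext fun a => ?_⟩
  have : (p.quotKerEquivOfSurjective hp).symm (p a) = (LinearMap.ker p).mkQ a := by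
    rw [LinearEquiv.symm_apply_eq]; rfl
  simp only [LinearMap.comp_apply, LinearEquiv.coe_coe, this]
  rfl

theorem isConeatMono_mkQ_sSup_comp {M N : Type u} [AddCommGroup M] [Module R M] [AddCommGroup N]
    [Module R N] (i : M →ₗ[R] N) (c : Set (Submodule R N)) (hne : c.Nonempty)
    (hc : IsChain (· ≤ ·) c) (h : ∀ K ∈ c, IsConeatMono (K.mkQ.comp i)) :
    IsConeatMono ((sSup c).mkQ.comp i) := by
  intro I hI a ha
  obtain ⟨y, hy, hya⟩ := exists_preimage_mem_rIdealSMul (sSup c).mkQ I Set.univ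
    (by rw [(Submodule.mkQ_surjective _).range_eq]) ha
  have hmem : y - i a ∈ sSup c := (Submodule.Quotient.eq _).1 hya
  obtain ⟨K, hK, hmK⟩ := (Submodule.mem_sSup_of_directed hne hc.directedOn).1 hmem
  refine h K hK I hI a ?_
  have : K.mkQ y = K.mkQ (i a) := (Submodule.Quotient.eq _).2 hmK
  rw [LinearMap.comp_apply, ← this]
  exact map_mem_rIdealSMul_s13 _ I _ _ (Set.mapsTo_univ _ _) hy

/-- Every coneat monomorphism becomes coneat essential in a suitable quotient of its codomain. -/
theorem IsConeatMono.exists_isConeatEssential_mkQ {M W : Type u} [AddCommGroup M] [Module R M]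
    [AddCommGroup W] [Module R W] {e : M →ₗ[R] W} (he : IsConeatMono e) :
    ∃ K : Submodule R W, IsConeatMono (K.mkQ.comp e) ∧ IsConeatEssential (K.mkQ.comp e) := by
  obtain ⟨K, -, hK⟩ := zorn_le_nonempty₀ {K : Submodule R W | IsConeatMono (K.mkQ.comp e)}
    (fun c hc hchain y hy => ⟨sSup c, isConeatMono_mkQ_sSup_comp e c ⟨y, hy⟩ hchain hc,
      fun z hz => le_sSup hz⟩) ⊥ (by
      refine IsConeatMono.of_comp (g := (⊥ : Submodule R W).liftQ LinearMap.id bot_le) ?_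
      exact he)
  refine ⟨K, hK.prop, fun X _ _ φ hφ => ?_⟩
  have hle : K ≤ LinearMap.ker (φ.comp K.mkQ) := by
    intro x hx
    simp [(Submodule.Quotient.mk_eq_zero K).2 hx]
  have hmem : IsConeatMono ((LinearMap.ker (φ.comp K.mkQ)).mkQ.comp e) := by
    refine IsConeatMono.of_comp
      (g := (LinearMap.ker (φ.comp K.mkQ)).liftQ (φ.comp K.mkQ) le_rfl) ?_
    exact hφ
  have hge := hK.le_of_ge hmem hle
  refine (injective_iff_map_eq_zero φ).2 fun x hx => ?_
  obtain ⟨w, rfl⟩ := K.mkQ_surjective x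
  exact (Submodule.Quotient.mk_eq_zero K).2 (hge hx)

/-- The submodule of `M × R^(Ω)` generated by `M` and the free generators in `A`. -/
noncomputable def partialFree (R : Type u) [Ring R] (M : Type u) [AddCommGroup M]
    [Module R M] {Ω : Type u} (A : Set Ω) : Submodule R (M × (Ω →₀ R)) :=
  (Finsupp.supported R R A).comap (LinearMap.snd R M (Ω →₀ R))

section partialFree

variable {M : Type u} [AddCommGroup M] [Module R M] {Ω : Type u}

theorem partialFree_mono {A A' : Set Ω} (h : A ⊆ A') : partialFree R M A ≤ partialFree R M A' :=
  Submodule.comap_mono (Finsupp.supported_mono h)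

theorem inl_mem_partialFree (A : Set Ω) (m : M) :
    LinearMap.inl R M (Ω →₀ R) m ∈ partialFree R M A :=
  zero_mem (Finsupp.supported R R A)

theorem single_mem_partialFree {A : Set Ω} {a : Ω} (ha : a ∈ A) :
    ((0 : M), Finsupp.single a (1 : R)) ∈ partialFree R M A :=
  Finsupp.single_mem_supported R 1 ha

theorem exists_mem_partialFree_of_sUnion (c : Set (Set Ω)) (hne : c.Nonempty)
    (hc : DirectedOn (· ⊆ ·) c) {x : M × (Ω →₀ R)} (hx : x ∈ partialFree R M (⋃₀ c)) :
    ∃ A ∈ c, x ∈ partialFree R M A := by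
  have hx' : (x.2.support : Set Ω) ⊆ ⋃₀ c := hx
  obtain ⟨A, hA, h⟩ := DirectedOn.exists_mem_subset_of_finset_subset_biUnion
    (s := x.2.support) hne (f := id) hc (by simpa [Set.sUnion_eq_biUnion] using hx')
  exact ⟨A, hA, h⟩

theorem eqOn_partialFree {X : Type*} [AddCommGroup X] [Module R X] {A : Set Ω}
    (φ ψ : M × (Ω →₀ R) →ₗ[R] X) (hl : φ.comp (LinearMap.inl R M _) = ψ.comp (LinearMap.inl R M _))
    (h : ∀ a ∈ A, φ (0, Finsupp.single a 1) = ψ (0, Finsupp.single a 1))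
    {x : M × (Ω →₀ R)} (hx : x ∈ partialFree R M A) : φ x = ψ x := by
  have key : Set.EqOn (φ.comp (LinearMap.inr R M _)) (ψ.comp (LinearMap.inr R M _))
      (Finsupp.supported R R A : Set (Ω →₀ R)) := by
    rw [Finsupp.supported_eq_span_single]
    refine LinearMap.eqOn_span ?_
    rintro _ ⟨a, ha, rfl⟩
    exact h a ha
  have h1 := LinearMap.congr_fun hl x.1
  have h2 := key hx
  have hsum : x = LinearMap.inl R M (Ω →₀ R) x.1 + LinearMap.inr R M (Ω →₀ R) x.2 := by
    simp
  rw [hsum, map_add, map_add]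
  exact congrArg₂ (· + ·) h1 h2

end partialFree

/-- A presentation, by generators in `A` and relations `K`, of a coneat essential extension
of `M` in which distinct generators are distinct. -/
structure IsEssentialPresentation {M Ω : Type u} [AddCommGroup M] [Module R M]
    (A : Set Ω) (K : Submodule R (M × (Ω →₀ R))) : Prop where
  le : K ≤ partialFree R M A
  coneat : IsConeatMono (K.mkQ.comp (LinearMap.inl R M (Ω →₀ R)))
  essential : ∀ (X : Type u) [AddCommGroup X] [Module R X] (φ : M × (Ω →₀ R) →ₗ[R] X),
    K ≤ LinearMap.ker φ → IsConeatMono (φ.comp (LinearMap.inl R M (Ω →₀ R))) →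
    partialFree R M A ⊓ LinearMap.ker φ ≤ K
  inj : ∀ a ∈ A, ∀ b ∈ A,
    ((0 : M), Finsupp.single a (1 : R)) - (0, Finsupp.single b 1) ∈ K → a = b

namespace IsEssentialPresentation

variable {M Ω : Type u} [AddCommGroup M] [Module R M]

theorem empty : IsEssentialPresentation (∅ : Set Ω) (⊥ : Submodule R (M × (Ω →₀ R))) where
  le := bot_le
  coneat := by
    refine IsConeatMono.of_comp (g := (⊥ : Submodule R (M × (Ω →₀ R))).liftQ
      (LinearMap.fst R M (Ω →₀ R)) bot_le) ?_
    exact fun I _ a ha => ha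
  essential X _ _ φ _ hφ x hx := by
    have h0 : x.2 = 0 := by
      have : x.2 ∈ Finsupp.supported R R (∅ : Set Ω) := hx.1
      simpa using this
    have hx1 : x = LinearMap.inl R M (Ω →₀ R) x.1 := Prod.ext rfl h0
    have h2 : φ.comp (LinearMap.inl R M (Ω →₀ R)) x.1 = 0 := by
      rw [LinearMap.comp_apply, ← hx1]; exact hx.2
    have h1 : x.1 = 0 := (injective_iff_map_eq_zero _).1 hφ.injective _ h2
    exact (Submodule.mem_bot R).2 (Prod.ext h1 h0)
  inj a ha := ha.elim

theorem sSup_chain (c : Set (Set Ω × Submodule R (M × (Ω →₀ R)))) (hne : c.Nonempty)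
    (hc : IsChain (· ≤ ·) c) (h : ∀ p ∈ c, IsEssentialPresentation p.1 p.2) :
    IsEssentialPresentation (⋃₀ (Prod.fst '' c)) (sSup (Prod.snd '' c)) := by
  have hc1 : IsChain (· ⊆ ·) (Prod.fst '' c) := by
    rintro _ ⟨p, hp, rfl⟩ _ ⟨q, hq, rfl⟩ -
    exact (hc.total hp hq).imp (fun h => h.1) fun h => h.1
  have hc2 : IsChain (· ≤ ·) (Prod.snd '' c) := by
    rintro _ ⟨p, hp, rfl⟩ _ ⟨q, hq, rfl⟩ -
    exact (hc.total hp hq).imp (fun h => h.2) fun h => h.2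
  have hle : ∀ p ∈ c, p.2 ≤ sSup (Prod.snd '' c) := fun p hp => le_sSup ⟨p, hp, rfl⟩
  refine ⟨sSup_le ?_, isConeatMono_mkQ_sSup_comp _ _ (hne.image _) hc2 ?_, ?_, ?_⟩
  · rintro _ ⟨p, hp, rfl⟩
    exact (h p hp).le.trans (partialFree_mono (Set.subset_sUnion_of_mem ⟨p, hp, rfl⟩))
  · rintro _ ⟨p, hp, rfl⟩
    exact (h p hp).coneat
  · rintro X _ _ φ hK hφ x ⟨hx, hx0⟩
    obtain ⟨_, ⟨p, hp, rfl⟩, hxp⟩ :=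
      exists_mem_partialFree_of_sUnion _ (hne.image _) hc1.directedOn hx
    exact hle p hp ((h p hp).essential X φ ((hle p hp).trans hK) hφ ⟨hxp, hx0⟩)
  · rintro a ⟨_, ⟨p, hp, rfl⟩, ha⟩ b ⟨_, ⟨q, hq, rfl⟩, hb⟩ hab
    obtain ⟨_, ⟨r, hr, rfl⟩, hr'⟩ :=
      (Submodule.mem_sSup_of_directed (hne.image _) hc2.directedOn).1 hab
    obtain ⟨s, hs, hps, hqs⟩ := hc.directedOn p hp q hq
    obtain ⟨t, ht, hst, hrt⟩ := hc.directedOn s hs r hr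
    exact (h t ht).inj a ((hps.trans hst).1 ha) b ((hqs.trans hst).1 hb) (hrt.2 hr')

theorem exists_maximal : ∃ p : Set Ω × Submodule R (M × (Ω →₀ R)),
    Maximal (fun p => IsEssentialPresentation p.1 p.2) p := by
  obtain ⟨p, -, hp⟩ := zorn_le_nonempty₀
    {p : Set Ω × Submodule R (M × (Ω →₀ R)) | IsEssentialPresentation p.1 p.2}
    (fun c hc hchain y hy => ⟨(⋃₀ (Prod.fst '' c), sSup (Prod.snd '' c)),
      sSup_chain c ⟨y, hy⟩ hchain hc, fun z hz =>
      ⟨Set.subset_sUnion_of_mem ⟨z, hz, rfl⟩, le_sSup ⟨z, hz, rfl⟩⟩⟩) (∅, ⊥) empty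
  exact ⟨p, hp⟩

/-- A surjection from a free extension of `M` onto a coneat essential extension of `M` gives an
essential presentation. -/
theorem of_surjective {C : Type u} [AddCommGroup C] [Module R C] {A : Set Ω}
    (φ : M × (Ω →₀ R) →ₗ[R] C) (he : IsConeatMono (φ.comp (LinearMap.inl R M (Ω →₀ R))))
    (hess : IsConeatEssential (φ.comp (LinearMap.inl R M (Ω →₀ R))))
    (hsurj : ∀ c, ∃ x ∈ partialFree R M A, φ x = c)
    (hinj : Set.InjOn (fun a => φ (0, Finsupp.single a 1)) A) :
    IsEssentialPresentation A (partialFree R M A ⊓ LinearMap.ker φ) := by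
  refine ⟨inf_le_left, ?_, ?_, ?_⟩
  · exact IsConeatMono.of_comp
      (g := (partialFree R M A ⊓ LinearMap.ker φ).liftQ φ inf_le_right) he
  · rintro X _ _ ψ hK hψ x ⟨hx, hx0⟩
    obtain ⟨θ, hθ⟩ := exists_comp_eq_of_ker_le (φ.domRestrict (partialFree R M A))
      (fun c => by obtain ⟨x, hx, rfl⟩ := hsurj c; exact ⟨⟨x, hx⟩, rfl⟩)
      (ψ.domRestrict (partialFree R M A)) (fun (x : partialFree R M A) hx => hK ⟨x.2, hx⟩)
    have hθ' : ∀ x ∈ partialFree R M A, θ (φ x) = ψ x := fun x hx => LinearMap.congr_fun hθ ⟨x, hx⟩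
    have hθi : Function.Injective θ := by
      refine hess X θ ?_
      convert hψ using 1
      exact LinearMap.ext fun m => hθ' _ (inl_mem_partialFree A m)
    exact ⟨hx, (injective_iff_map_eq_zero θ).1 hθi _ ((hθ' x hx).trans hx0)⟩
  · intro a ha b hb hab
    refine hinj ha hb (sub_eq_zero.1 ?_)
    simpa only [map_sub] using LinearMap.mem_ker.1 hab.2

end IsEssentialPresentation

theorem exists_disjoint_fiber {C : Type*} (A : Set (Set C × C)) (f : Set C × C → C)
    (hf : Set.InjOn f A) : ∃ s : Set C, ∀ c, (s, c) ∉ A := by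
  by_contra! h
  choose g hg using h
  refine Function.cantor_injective (fun s => f (s, g s)) fun s t hst => ?_
  exact congrArg Prod.fst (hf (hg s) (hg t) hst)

theorem IsEssentialPresentation.surjOn_of_maximal {M C : Type u} [AddCommGroup M] [Module R M]
    [AddCommGroup C] [Module R C] {e : M →ₗ[R] C} (he : IsConeatMono e)
    (hess : IsConeatEssential e)
    {A : Set (Set C × C)} {K : Submodule R (M × (Set C × C →₀ R))}
    (hmax : Maximal (fun p : Set (Set C × C) × Submodule R (M × (Set C × C →₀ R)) =>
      IsEssentialPresentation p.1 p.2) (A, K))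
    (φ : M × (Set C × C →₀ R) →ₗ[R] C) (hK : K ≤ LinearMap.ker φ)
    (hφ : φ.comp (LinearMap.inl R M _) = e) : ∀ c, ∃ x ∈ partialFree R M A, φ x = c := by
  classical
  have hP : IsEssentialPresentation A K := hmax.prop
  have hinj : Set.InjOn (fun a => φ (0, Finsupp.single a 1)) A := by
    intro a ha b hb hab
    refine hP.inj a ha b hb (hP.essential C φ hK (hφ ▸ he) ⟨?_, ?_⟩)
    · exact sub_mem (single_mem_partialFree ha) (single_mem_partialFree hb)
    · change φ (_ - _) = 0
      rw [map_sub]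
      exact sub_eq_zero.2 hab
  obtain ⟨s, hs⟩ := exists_disjoint_fiber A _ hinj
  by_contra! hc
  obtain ⟨c₀, hc₀⟩ := hc
  let A' : Set (Set C × C) := A ∪ {p | p.1 = s ∧ ∀ x ∈ partialFree R M A, φ x ≠ p.2}
  let v : Set C × C → C := fun a => if a ∈ A then φ (0, Finsupp.single a 1) else a.2
  let φ' : M × (Set C × C →₀ R) →ₗ[R] C := e.coprod (Finsupp.linearCombination R v)
  have hφ'l : φ'.comp (LinearMap.inl R M _) = e := LinearMap.coprod_inl _ _
  have hφ'v : ∀ a, φ' (0, Finsupp.single a 1) = v a := fun a => by simp [φ']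
  have hv : ∀ a ∈ A, v a = φ (0, Finsupp.single a 1) := fun a ha => if_pos ha
  have hv' : ∀ a : Set C × C, a.1 = s → v a = a.2 := fun a ha => if_neg (by
    obtain ⟨t, c⟩ := a
    obtain rfl : t = s := ha
    exact hs c)
  have heq : ∀ x ∈ partialFree R M A, φ' x = φ x := fun x hx =>
    eqOn_partialFree φ' φ (hφ'l.trans hφ.symm) (fun a ha => (hφ'v a).trans (hv a ha)) hx
  have hAA' : A ⊆ A' := Set.subset_union_left
  have hpres : IsEssentialPresentation A' (partialFree R M A' ⊓ LinearMap.ker φ') := by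
    refine IsEssentialPresentation.of_surjective φ' (hφ'l ▸ he) (hφ'l ▸ hess) (fun c => ?_) ?_
    · by_cases hc : ∃ x ∈ partialFree R M A, φ x = c
      · obtain ⟨x, hx, rfl⟩ := hc
        exact ⟨x, partialFree_mono hAA' hx, heq x hx⟩
      · push Not at hc
        exact ⟨_, single_mem_partialFree (a := (s, c)) (Or.inr ⟨rfl, hc⟩),
          (hφ'v _).trans (hv' _ rfl)⟩
    · have hne : ∀ a ∈ A, ∀ b : Set C × C, (b.1 = s ∧ ∀ x ∈ partialFree R M A, φ x ≠ b.2) →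
          v a ≠ v b := fun a ha b hb hab => by
        rw [hv a ha, hv' b hb.1] at hab
        exact hb.2 _ (single_mem_partialFree ha) hab
      intro a ha b hb hab
      simp only [hφ'v] at hab
      rcases ha with ha | ha <;> rcases hb with hb | hb
      · rw [hv a ha, hv b hb] at hab
        exact hinj ha hb hab
      · exact (hne a ha b hb hab).elim
      · exact (hne b hb a ha hab.symm).elim
      · rw [hv' a ha.1, hv' b hb.1] at hab
        exact Prod.ext (ha.1.trans hb.1.symm) hab
  have hle : (A, K) ≤ (A', partialFree R M A' ⊓ LinearMap.ker φ') := by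
    refine ⟨hAA', fun x hx => ⟨partialFree_mono hAA' (hP.le hx), ?_⟩⟩
    exact (heq x (hP.le hx)).trans (hK hx)
  exact hs c₀ ((hmax.le_of_ge hpres hle).1 (Or.inr ⟨rfl, hc₀⟩))

/-- Endomorphisms over `M` of a weakly terminal coneat essential extension of `M` are
automorphisms. -/
theorem IsConeatEssential.bijective_of_comp_eq {M C : Type u} [AddCommGroup M] [Module R M]
    [AddCommGroup C] [Module R C] {e : M →ₗ[R] C} (he : IsConeatMono e)
    (hess : IsConeatEssential e)
    (hw : ∀ (N : Type u) [AddCommGroup N] [Module R N] (i : M →ₗ[R] N), IsConeatMono i →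
      ∃ h : N →ₗ[R] C, h.comp i = e)
    (f : C →ₗ[R] C) (hf : f.comp e = e) : Function.Bijective f := by
  refine ⟨hess C f (hf.symm ▸ he), fun c => ?_⟩
  obtain ⟨⟨A, K⟩, hmax⟩ := IsEssentialPresentation.exists_maximal (R := R) (M := M)
    (Ω := Set C × C)
  obtain ⟨h, hh⟩ := hw _ _ hmax.prop.coneat
  have hK : K ≤ LinearMap.ker (f.comp (h.comp K.mkQ)) := by
    intro x hx
    simp [(Submodule.Quotient.mk_eq_zero K).2 hx]
  obtain ⟨x, -, hx⟩ := IsEssentialPresentation.surjOn_of_maximal he hess hmax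
    (f.comp (h.comp K.mkQ)) hK (by rw [LinearMap.comp_assoc, LinearMap.comp_assoc, hh, hf]) c
  exact ⟨_, hx⟩

/-- Every module has a coneat injective envelope. -/
theorem exists_isConeatInjectiveEnvelope (M : Type u) [AddCommGroup M] [Module R M] :
    ∃ (E : ModuleCat.{u} R) (e : M →ₗ[R] E), IsConeatInjectiveEnvelope R e := by
  obtain ⟨W, i, hW, hi⟩ := exists_isConeatMono_isConeatInjective (R := R) M
  obtain ⟨K, he, hess⟩ := hi.exists_isConeatEssential_mkQ
  have hbij := hess.bijective_of_comp_eq he fun N _ _ k hk => by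
    obtain ⟨h, hh⟩ := hW.exists_extension hk i
    exact ⟨K.mkQ.comp h, by rw [LinearMap.comp_assoc, hh]⟩
  obtain ⟨j, hj⟩ := hW.exists_extension he i
  let q := LinearEquiv.ofBijective (K.mkQ.comp j) (hbij _ (by rw [LinearMap.comp_assoc, hj]))
  refine ⟨ModuleCat.of R (W ⧸ K), K.mkQ.comp i, he.injective, ?_,
    fun C hC g => hC.exists_extension he g, hbij⟩
  exact hW.of_retract j (q.symm.toLinearMap.comp K.mkQ) fun x => q.symm_apply_apply x

end Envelope

section Prod

variable {R : Type u} [Ring R]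

theorem IsConeatInjectiveEnvelope.prodMap {M₁ M₂ E₁ E₂ : Type u} [AddCommGroup M₁] [Module R M₁]
    [AddCommGroup M₂] [Module R M₂] [AddCommGroup E₁] [Module R E₁] [AddCommGroup E₂]
    [Module R E₂] {e₁ : M₁ →ₗ[R] E₁} {e₂ : M₂ →ₗ[R] E₂} (h₁ : IsConeatInjectiveEnvelope R e₁)
    (h₂ : IsConeatInjectiveEnvelope R e₂) : IsConeatInjectiveEnvelope R (e₁.prodMap e₂) := by
  obtain ⟨hi₁, hE₁, hf₁, hm₁⟩ := h₁
  obtain ⟨hi₂, hE₂, hf₂, hm₂⟩ := h₂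
  refine ⟨hi₁.prodMap hi₂, hE₁.prod hE₂, fun C hC g => ?_, fun f hf => ?_⟩
  · obtain ⟨k₁, hk₁⟩ := hf₁ C hC (g.comp (LinearMap.inl R M₁ M₂))
    obtain ⟨k₂, hk₂⟩ := hf₂ C hC (g.comp (LinearMap.inr R M₁ M₂))
    refine ⟨k₁.coprod k₂, LinearMap.ext fun m => ?_⟩
    have h1 : k₁ (e₁ m.1) = g (m.1, 0) := LinearMap.congr_fun hk₁ m.1
    have h2 : k₂ (e₂ m.2) = g (0, m.2) := LinearMap.congr_fun hk₂ m.2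
    simp [h1, h2, ← map_add]
  · have hf' : ∀ m₁ m₂, f (e₁ m₁, e₂ m₂) = (e₁ m₁, e₂ m₂) :=
      fun m₁ m₂ => LinearMap.congr_fun hf (m₁, m₂)
    have hl : ∀ m₁, f (e₁ m₁, 0) = (e₁ m₁, 0) := fun m₁ => by simpa using hf' m₁ 0
    have hr : ∀ m₂, f (0, e₂ m₂) = (0, e₂ m₂) := fun m₂ => by simpa using hf' 0 m₂
    have hsplit : ∀ x y, f (x, y) = f (x, 0) + f (0, y) := fun x y => by simp [← map_add]
    let a := LinearEquiv.ofBijective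
      ((LinearMap.fst R E₁ E₂).comp (f.comp (LinearMap.inl R E₁ E₂)))
      (hm₁ _ (LinearMap.ext fun m => congrArg Prod.fst (hl m)))
    have ha : ∀ x, a x = (f (x, 0)).1 := fun _ => rfl
    have haa : ∀ x, (f (a.symm x, 0)).1 = x := fun x => a.apply_symm_apply x
    -- the Schur complement of the upper left block of `f`
    let d : E₂ →ₗ[R] E₂ := (LinearMap.snd R E₁ E₂).comp (f.comp
      ((-(a.symm.toLinearMap.comp
        ((LinearMap.fst R E₁ E₂).comp (f.comp (LinearMap.inr R E₁ E₂))))).prod LinearMap.id))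
    have hd : ∀ y, d y = (f (-a.symm (f (0, y)).1, y)).2 := fun _ => rfl
    have hd0 : ∀ y, (f (-a.symm (f (0, y)).1, y)).1 = 0 := fun y => by
      have hneg : f (-a.symm (f (0, y)).1, 0) = -f (a.symm (f (0, y)).1, 0) := by
        simp [← map_neg]
      rw [hsplit, hneg, Prod.fst_add, Prod.fst_neg, haa, neg_add_cancel]
    have hfd : ∀ y, f (-a.symm (f (0, y)).1, y) = (0, d y) := fun y => Prod.ext (hd0 y) rfl
    have hdb : Function.Bijective d := hm₂ _ (LinearMap.ext fun m => by
      simp only [LinearMap.comp_apply]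
      rw [hd, hr, map_zero, neg_zero, hr])
    refine ⟨(injective_iff_map_eq_zero f).2 fun x hx => ?_, fun z => ?_⟩
    · obtain ⟨x, y⟩ := x
      have hx1 : x = -a.symm (f (0, y)).1 := by
        rw [← map_neg, LinearEquiv.eq_symm_apply, ha, eq_neg_iff_add_eq_zero, ← Prod.fst_add,
          ← hsplit, hx, Prod.fst_zero]
      rw [hx1, hfd] at hx
      have hy : y = 0 := (injective_iff_map_eq_zero d).1 hdb.1 y (congrArg Prod.snd hx)
      have h0 : f ((0 : E₁), (0 : E₂)) = 0 := map_zero f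
      rw [hx1, hy]
      simp [h0]
    · obtain ⟨y, hy⟩ := hdb.2 (z.2 - (f (a.symm z.1, 0)).2)
      refine ⟨(a.symm z.1, 0) + (-a.symm (f (0, y)).1, y), ?_⟩
      rw [map_add, hfd, hy]
      exact Prod.ext (by simp [haa]) (by simp)

theorem IsConeatInjectiveEnvelope.exists_injective {M E F : Type u} [AddCommGroup M] [Module R M]
    [AddCommGroup E] [Module R E] [AddCommGroup F] [Module R F] {e : M →ₗ[R] E} {e' : M →ₗ[R] F}
    (he : IsConeatInjectiveEnvelope R e) (he' : IsConeatInjectiveEnvelope R e') :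
    ∃ h : E →ₗ[R] F, h.comp e = e' ∧ Function.Injective h := by
  obtain ⟨h, hh⟩ := he.2.2.1 (ModuleCat.of R F) he'.2.1 e'
  obtain ⟨k, hk⟩ := he'.2.2.1 (ModuleCat.of R E) he.2.1 e
  refine ⟨h, hh, Function.Injective.of_comp (f := k) ?_⟩
  exact (he.2.2.2 (k.comp h) (by rw [LinearMap.comp_assoc, hh, hk])).1

/-- It suffices to check coneat relative injectivity on a single coneat injective envelope. -/
theorem IsConeatInjectiveEnvelope.isConeatRelInjective {M N E : Type u} [AddCommGroup M]
    [Module R M] [AddCommGroup N] [Module R N] [AddCommGroup E] [Module R E] {e : M →ₗ[R] E}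
    (he : IsConeatInjectiveEnvelope R e)
    (h : ∀ (f : N →ₗ[R] E) (n : N), f n ∈ LinearMap.range e) : IsConeatRelInjective R M N := by
  intro F e' he' f n
  obtain ⟨k, hk, hki⟩ := he'.exists_injective he
  obtain ⟨m, hm⟩ := h (k.comp f) n
  refine ⟨m, hki ?_⟩
  rw [← LinearMap.comp_apply, hk, hm, LinearMap.comp_apply]

/-- `M₁ × M₂` is coneat-`N`-injective if and only if both factors are. -/
theorem isConeatRelInjective_prod_left_iff (M₁ M₂ N : Type u) [AddCommGroup M₁] [Module R M₁]
    [AddCommGroup M₂] [Module R M₂] [AddCommGroup N] [Module R N] :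
    IsConeatRelInjective R (M₁ × M₂) N ↔
      IsConeatRelInjective R M₁ N ∧ IsConeatRelInjective R M₂ N := by
  obtain ⟨E₁, e₁, h₁⟩ := exists_isConeatInjectiveEnvelope (R := R) M₁
  obtain ⟨E₂, e₂, h₂⟩ := exists_isConeatInjectiveEnvelope (R := R) M₂
  have h := h₁.prodMap h₂
  refine ⟨fun H => ⟨h₁.isConeatRelInjective fun f n => ?_,
    h₂.isConeatRelInjective fun f n => ?_⟩, fun H => h.isConeatRelInjective fun f n => ?_⟩
  · obtain ⟨m, hm⟩ := H (ModuleCat.of R (E₁ × E₂)) _ h ((LinearMap.inl R E₁ E₂).comp f) n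
    exact ⟨m.1, congrArg Prod.fst hm⟩
  · obtain ⟨m, hm⟩ := H (ModuleCat.of R (E₁ × E₂)) _ h ((LinearMap.inr R E₁ E₂).comp f) n
    exact ⟨m.2, congrArg Prod.snd hm⟩
  · obtain ⟨m₁, hm₁⟩ := H.1 E₁ e₁ h₁ ((LinearMap.fst R E₁ E₂).comp f) n
    obtain ⟨m₂, hm₂⟩ := H.2 E₂ e₂ h₂ ((LinearMap.snd R E₁ E₂).comp f) n
    exact ⟨(m₁, m₂), Prod.ext hm₁ hm₂⟩

/-- `M` is coneat-`(N₁ × N₂)`-injective if and only if it is coneat injective relative to both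
factors. -/
theorem isConeatRelInjective_prod_right_iff (M N₁ N₂ : Type u) [AddCommGroup M] [Module R M]
    [AddCommGroup N₁] [Module R N₁] [AddCommGroup N₂] [Module R N₂] :
    IsConeatRelInjective R M (N₁ × N₂) ↔
      IsConeatRelInjective R M N₁ ∧ IsConeatRelInjective R M N₂ := by
  refine ⟨fun H => ⟨fun E e he f n => ?_, fun E e he f n => ?_⟩, fun H E e he f n => ?_⟩
  · exact H E e he (f.comp (LinearMap.fst R N₁ N₂)) (n, 0)
  · exact H E e he (f.comp (LinearMap.snd R N₁ N₂)) (0, n)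
  · have hn : n = LinearMap.inl R N₁ N₂ n.1 + LinearMap.inr R N₁ N₂ n.2 := by simp
    rw [hn, map_add]
    exact add_mem (H.1 E e he (f.comp (LinearMap.inl R N₁ N₂)) n.1)
      (H.2 E e he (f.comp (LinearMap.inr R N₁ N₂)) n.2)

end Prod

/-- `M₁ ⊕ M₂` is coneat quasi injective if and only if `Mᵢ` is
coneat-`Mⱼ`-injective for all `i, j ∈ {1, 2}`. -/
theorem prod_coneatQuasiInjective_iff (R : Type u) [Ring R]
    (M₁ M₂ : Type u) [AddCommGroup M₁] [Module R M₁] [AddCommGroup M₂] [Module R M₂] :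
    IsConeatQuasiInjective R (M₁ × M₂) ↔
      (IsConeatRelInjective R M₁ M₁ ∧ IsConeatRelInjective R M₁ M₂ ∧
        IsConeatRelInjective R M₂ M₁ ∧ IsConeatRelInjective R M₂ M₂) := by
  rw [IsConeatQuasiInjective, isConeatRelInjective_prod_left_iff,
    isConeatRelInjective_prod_right_iff, isConeatRelInjective_prod_right_iff, and_assoc]
end
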